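/- There do not exist positive integers j and q, complex numbers c_k, a_{kr}, b_{kr} (for 1 ≤ k ≤ j, 1 ≤ r ≤ q) and nonnegative integers d_{kr} such that T(s,s,s) = Σ_{k=1}^{j} c_k ∏_{r=1}^{q} ζ(a_{kr} s + b_{kr})^{d_{kr}} holds for every complex s with Re s > 2/3. -/

import Mathlib

open Real Complex

/-- The Tornheim double zeta function, as a double series over positive integers. -/
noncomputable def tornheim (s t u : ℂ) : ℂ :=
  ∑' p : ℕ+ × ℕ+, 1 / ((p.1 : ℂ) ^ s * (p.2 : ℂ) ^ t * ((p.1 : ℂ) + (p.2 : ℂ)) ^ u)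


open Filter Topology

/-- generalized binomial coefficient -/
noncomputable def bin (a : ℂ) (n : ℕ) : ℂ := ∏ j ∈ Finset.range n, ((a - j) / (j + 1))

/-- majorant of the binomial coefficient -/
noncomputable def rb (R : ℝ) (n : ℕ) : ℝ := ∏ j ∈ Finset.range n, ((R + 1 + j) / (j + 1))

lemma choose_eq_bin (a : ℂ) (n : ℕ) : Ring.choose a n = bin a n := by
  rw [Ring.choose_eq_smul]
  have h : (descPochhammer ℤ n).smeval a = ∏ j ∈ Finset.range n, (a - j) := by
    rw [← Polynomial.aeval_eq_smeval, Polynomial.aeval_def, Polynomial.eval₂_eq_eval_map,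
      descPochhammer_map, descPochhammer_eval_eq_prod_range]
  rw [h, bin, Finset.prod_div_distrib]
  have h2 : (∏ j ∈ Finset.range n, ((j : ℂ) + 1)) = (n.factorial : ℂ) := by
    rw [← Finset.prod_range_add_one_eq_factorial]; push_cast; rfl
  rw [h2, smul_eq_mul, div_eq_inv_mul]

lemma bin_differentiable (n : ℕ) : Differentiable ℂ (fun a => bin a n) := by
  unfold bin
  apply Differentiable.fun_finsetProd
  intro i _
  fun_prop

lemma rb_nonneg {R : ℝ} (hR : 0 ≤ R) (n : ℕ) : 0 ≤ rb R n :=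
  Finset.prod_nonneg fun j _ => by positivity

lemma bin_norm_le {R : ℝ} {s : ℂ} (hs : ‖s‖ ≤ R) (n : ℕ) : ‖bin (s - 1) n‖ ≤ rb R n := by
  unfold bin rb
  rw [norm_prod]
  apply Finset.prod_le_prod
  · intros; positivity
  · intro j _
    rw [norm_div]
    have h1 : ‖(j : ℂ) + 1‖ = j + 1 := by
      have : ((j : ℂ) + 1) = ((j + 1 : ℕ) : ℂ) := by push_cast; rfl
      rw [this, Complex.norm_natCast]; push_cast; rfl
    rw [h1]
    gcongr
    calc ‖s - 1 - j‖ ≤ ‖s - 1‖ + ‖(j : ℂ)‖ := norm_sub_le _ _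
      _ ≤ ‖s‖ + ‖(1 : ℂ)‖ + ‖(j : ℂ)‖ := by gcongr; exact norm_sub_le _ _
      _ ≤ _ := by simp; linarith

lemma rb_summable {R : ℝ} (hR : 0 ≤ R) : Summable (fun n => rb R n * (1 / 2 : ℝ) ^ n) := by
  have hpos : ∀ n, 0 < rb R n * (1 / 2 : ℝ) ^ n := fun n => by
    have : 0 < rb R n := Finset.prod_pos fun j _ => by positivity
    positivity
  apply summable_of_ratio_test_tendsto_lt_one (l := 1 / 2) (by norm_num)
  · exact Eventually.of_forall fun n => (hpos n).ne'
  · have h1 : ∀ n : ℕ, ‖rb R (n + 1) * (1 / 2 : ℝ) ^ (n + 1)‖ / ‖rb R n * (1 / 2 : ℝ) ^ n‖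
        = (1 + R / ((n : ℝ) + 1)) * (1 / 2) := by
      intro n
      rw [Real.norm_of_nonneg (hpos _).le, Real.norm_of_nonneg (hpos _).le,
        div_eq_iff (hpos n).ne']
      have : rb R (n + 1) = rb R n * ((R + 1 + n) / (n + 1)) := Finset.prod_range_succ _ _
      rw [this, pow_succ]
      field_simp
      ring
    simp_rw [h1]
    have h2 : Tendsto (fun n : ℕ => R / ((n : ℝ) + 1)) atTop (𝓝 0) := by
      have := (tendsto_one_div_add_atTop_nhds_zero_nat (𝕜 := ℝ)).const_mul R
      simpa [div_eq_mul_inv] using this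
    simpa using (h2.const_add 1).mul_const (1 / 2 : ℝ)

/-- coefficients -/
noncomputable def zc (k : ℕ) (s : ℂ) : ℂ :=
  2 * bin (s - 1) (2 * k) * riemannZeta (1 - s + 2 * k)

/-- all coefficients -/
noncomputable def co : Option ℕ → ℂ → ℂ
  | none, _ => 1
  | some k, s => zc k s

/-- all exponents -/
noncomputable def ex : Option ℕ → ℂ → ℂ
  | none, s => s - 1
  | some k, _ => ((2 * k : ℕ) : ℂ)

lemma zeta_norm_le_of_two_le {w : ℂ} (hw : 2 ≤ w.re) :
    ‖riemannZeta w‖ ≤ ∑' n : ℕ, 1 / (n : ℝ) ^ (2 : ℝ) := by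
  have hs : Summable (fun n : ℕ => 1 / (n : ℝ) ^ (2 : ℝ)) :=
    Real.summable_one_div_nat_rpow.2 (by norm_num)
  rw [zeta_eq_tsum_one_div_nat_cpow (by linarith)]
  refine tsum_of_norm_bounded hs.hasSum fun n => ?_
  rcases Nat.eq_zero_or_pos n with rfl | hn
  · have : w ≠ 0 := by rintro rfl; simp at hw; linarith
    simp [Complex.zero_cpow this]
  · rw [norm_div, norm_one, Complex.norm_natCast_cpow_of_pos hn]
    gcongr
    exact_mod_cast hn

lemma zeta_bound (R δ : ℝ) (hδ : 0 < δ) : ∃ M : ℝ, 0 ≤ M ∧ ∀ s : ℂ, ‖s‖ ≤ R →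
    (∀ n : ℤ, δ ≤ ‖s - n‖) → ∀ k : ℕ, ‖riemannZeta (1 - s + 2 * k)‖ ≤ M := by
  set K : Set ℂ := Metric.closedBall 0 R ∩ ⋂ n : ℤ, {s : ℂ | δ ≤ ‖s - n‖} with hK
  have hKc : IsCompact K := by
    apply (isCompact_closedBall 0 R).inter_right
    apply isClosed_iInter
    intro n
    exact isClosed_le continuous_const (by fun_prop)
  have h1 : ∀ k : ℕ, ∃ M : ℝ, ∀ s ∈ K, ‖riemannZeta (1 - s + 2 * k)‖ ≤ M := by
    intro k
    apply hKc.exists_bound_of_continuousOn (f := fun s => riemannZeta (1 - s + 2 * k))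
    intro s hs
    apply ContinuousAt.continuousWithinAt
    have hne : 1 - s + 2 * k ≠ 1 := by
      intro h
      have : s = ((2 * k : ℤ) : ℂ) := by push_cast; linear_combination -h
      have h2 := Set.mem_iInter.1 hs.2 (2 * k : ℤ)
      simp only [Set.mem_ofPred_eq] at h2
      rw [← this] at h2
      simp at h2
      linarith
    exact ContinuousAt.comp (f := fun s : ℂ => 1 - s + 2 * (k : ℂ)) (g := riemannZeta) (x := s)
      (differentiableAt_riemannZeta hne).continuousAt (by fun_prop)
  choose M hM using h1
  obtain ⟨k0, hk0⟩ := exists_nat_ge (R + 1)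
  have hz : 0 ≤ ∑' n : ℕ, 1 / (n : ℝ) ^ (2 : ℝ) := tsum_nonneg fun n => by positivity
  have hsum : 0 ≤ ∑ k ∈ Finset.range k0, |M k| := Finset.sum_nonneg fun _ _ => abs_nonneg _
  refine ⟨(∑' n : ℕ, 1 / (n : ℝ) ^ (2 : ℝ)) + ∑ k ∈ Finset.range k0, |M k|, by positivity, ?_⟩
  intro s hsR hsn k
  have hsK : s ∈ K := ⟨by simpa using hsR, Set.mem_iInter.2 hsn⟩
  by_cases hk : k < k0
  · have h3 : |M k| ≤ ∑ k ∈ Finset.range k0, |M k| :=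
      Finset.single_le_sum (f := fun k => |M k|) (fun _ _ => abs_nonneg _) (Finset.mem_range.2 hk)
    linarith [hM k s hsK, le_abs_self (M k)]
  · push Not at hk
    have h4 : 2 ≤ (1 - s + 2 * k : ℂ).re := by
      have : (1 - s + 2 * k : ℂ).re = 1 - s.re + 2 * k := by simp
      rw [this]
      have := (abs_le.1 ((Complex.abs_re_le_norm s).trans hsR)).2
      have hk' : (k0 : ℝ) ≤ k := by exact_mod_cast hk
      have : 0 ≤ ‖s‖ := norm_nonneg _
      linarith
    linarith [zeta_norm_le_of_two_le h4]

lemma co_bound (R δ : ℝ) (hδ : 0 < δ) : ∃ v : Option ℕ → ℝ, Summable v ∧ ∀ s : ℂ, ‖s‖ ≤ R →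
    (∀ n : ℤ, δ ≤ ‖s - n‖) → ∀ i, ‖co i s‖ * (1 / 2 : ℝ) ^ (ex i s).re ≤ v i := by
  by_cases hR : 0 ≤ R
  swap
  · exact ⟨fun _ => 0, summable_zero, fun s hs => absurd ((norm_nonneg s).trans hs) hR⟩
  obtain ⟨M, hM0, hM⟩ := zeta_bound R δ hδ
  refine ⟨fun i => i.elim ((1 / 2 : ℝ) ^ (-R - 1)) (fun k => 2 * M * (rb R (2 * k) * (1 / 2 : ℝ) ^ (2 * k))),
    ?_, ?_⟩
  · apply (Equiv.optionEquivSumPUnit.{0} ℕ).symm.summable_iff.1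
    apply Summable.sum
    · apply Summable.mul_left
      exact (rb_summable hR).comp_injective (i := fun k : ℕ => 2 * k)
        (mul_right_injective₀ two_ne_zero)
    · exact (hasSum_fintype _).summable
  · intro s hs hn i
    cases i with
    | none =>
      simp only [co, ex, norm_one, one_mul, Option.elim]
      apply Real.rpow_le_rpow_of_exponent_ge (by norm_num) (by norm_num)
      have := (abs_le.1 ((Complex.abs_re_le_norm s).trans hs)).1
      simp; linarith
    | some k =>
      simp only [co, ex, Option.elim, zc, norm_mul, Complex.natCast_re, Real.rpow_natCast]
      rw [Complex.norm_ofNat]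
      have h1 := bin_norm_le hs (2 * k)
      have h2 := hM s hs hn k
      calc 2 * ‖bin (s - 1) (2 * k)‖ * ‖riemannZeta (1 - s + 2 * k)‖ * (1 / 2) ^ (2 * k)
          ≤ 2 * rb R (2 * k) * M * (1 / 2) ^ (2 * k) := by
            gcongr
            have := rb_nonneg hR (2 * k)
            positivity
        _ = _ := by ring

lemma hasSum_opt {f : Option ℕ → ℂ} {a : ℂ} (h : HasSum (fun k => f (some k)) a) :
    HasSum f (f none + a) := by
  rw [← (Equiv.optionEquivSumPUnit.{0} ℕ).symm.hasSum_iff]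
  rw [add_comm]
  apply HasSum.sum
  · exact h
  · exact hasSum_unique _

lemma HasSum.congr_aux {ι : Type} {f : ι → ℂ} {a b : ℂ} (h : HasSum f a) (hab : b = a) :
    HasSum f b := hab ▸ h

/-- the open upper half plane -/
def HH : Set ℂ := {s : ℂ | 0 < s.im}

lemma HH_open : IsOpen HH := isOpen_lt continuous_const Complex.continuous_im

lemma norm_sub_int_ge (s : ℂ) (n : ℤ) : s.im ≤ ‖s - n‖ := by
  have h := Complex.abs_im_le_norm (s - n)
  simp at h
  exact (le_abs_self _).trans h

lemma HH_diff {ι : Type} (F : ι → ℂ → ℂ) (hF : ∀ i, DifferentiableOn ℂ (F i) HH)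
    (hb : ∀ R δ : ℝ, 0 < δ → ∃ u : ι → ℝ, Summable u ∧ ∀ s : ℂ, ‖s‖ ≤ R → δ ≤ s.im →
      ∀ i, ‖F i s‖ ≤ u i) :
    DifferentiableOn ℂ (fun s => ∑' i, F i s) HH := by
  intro s hs
  have hs' : 0 < s.im := hs
  obtain ⟨u, hu, hle⟩ := hb (‖s‖ + 1) (s.im / 2) (by positivity)
  set W : Set ℂ := {z | ‖z‖ < ‖s‖ + 1} ∩ {z | s.im / 2 < z.im} with hW
  have hWo : IsOpen W := (isOpen_lt continuous_norm continuous_const).inter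
    (isOpen_lt continuous_const Complex.continuous_im)
  have hsub : W ⊆ HH := fun z hz => by
    have h1 : s.im / 2 < z.im := hz.2
    show 0 < z.im
    linarith
  have hsW : s ∈ W := ⟨by show ‖s‖ < ‖s‖ + 1; linarith, by show s.im / 2 < s.im; linarith⟩
  have := differentiableOn_tsum_of_summable_norm hu (fun i => (hF i).mono hsub) hWo
    (fun i w hw => hle w (le_of_lt hw.1) (le_of_lt hw.2) i)
  exact ((this s hsW).differentiableAt (hWo.mem_nhds hsW)).differentiableWithinAt

lemma bin_hasSum (a z : ℂ) (hz : ‖z‖ < 1) : HasSum (fun n => bin a n * z ^ n) ((1 + z) ^ a) := by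
  have h := (Complex.one_add_cpow_hasFPowerSeriesOnBall_zero (a := a)).hasSum (y := z) (by
    simp [Metric.eball, edist_zero_right, enorm_eq_nnnorm]
    exact_mod_cast hz)
  simp only [zero_add] at h
  refine h.congr_fun fun n => ?_
  rw [binomialSeries_apply, choose_eq_bin]
  simp

lemma bin_even_hasSum (a z : ℂ) (hz : ‖z‖ < 1) :
    HasSum (fun k => 2 * bin a (2 * k) * z ^ (2 * k)) ((1 + z) ^ a + (1 - z) ^ a) := by
  have h1 := bin_hasSum a z hz
  have h2 := bin_hasSum a (-z) (by simpa using hz)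
  have h3 := h1.add h2
  rw [← sub_eq_add_neg] at h3
  have hinj : Function.Injective (fun k : ℕ => 2 * k) := mul_right_injective₀ two_ne_zero
  rw [← hinj.hasSum_iff] at h3
  · refine h3.congr_fun fun k => ?_
    simp only [Function.comp]
    rw [Even.neg_pow (even_two_mul k)]
    ring
  · intro n hn
    have : Odd n := by
      rw [← Nat.not_even_iff_odd]
      rintro ⟨m, hm⟩
      exact hn ⟨m, by simp only; omega⟩
    rw [this.neg_pow]; ring

lemma zc_diff (k : ℕ) : DifferentiableOn ℂ (zc k) HH := by
  intro s hs
  have hs' : 0 < s.im := hs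
  apply DifferentiableAt.differentiableWithinAt
  unfold zc
  have hne : 1 - s + 2 * k ≠ 1 := by
    intro h
    have := congrArg Complex.im h
    simp at this
    linarith
  apply DifferentiableAt.mul
  · apply DifferentiableAt.const_mul
    exact DifferentiableAt.comp (f := fun s : ℂ => s - 1) (g := fun a => bin a (2 * k)) s
      (bin_differentiable _ _) (by fun_prop)
  · exact DifferentiableAt.comp (f := fun s : ℂ => 1 - s + 2 * (k : ℂ)) (g := riemannZeta) s
      (differentiableAt_riemannZeta hne) (by fun_prop)

lemma zc_pow_bound (x : ℝ) (hx : 0 < x) (hx2 : x ≤ 1 / 2) (R δ : ℝ) (hδ : 0 < δ) :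
    ∃ u : ℕ → ℝ, Summable u ∧ ∀ s : ℂ, ‖s‖ ≤ R → δ ≤ s.im →
      ∀ k, ‖zc k s * (x : ℂ) ^ (2 * k)‖ ≤ u k := by
  obtain ⟨v, hv, hle⟩ := co_bound R δ hδ
  refine ⟨fun k => v (some k), hv.comp_injective (Option.some_injective _), ?_⟩
  intro s hs him k
  have h := hle s hs (fun n => him.trans (norm_sub_int_ge s n)) (some k)
  simp only [co, ex, Complex.natCast_re, Real.rpow_natCast] at h
  refine le_trans ?_ h
  rw [norm_mul, norm_pow, Complex.norm_real, Real.norm_of_nonneg hx.le]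
  gcongr

lemma hurwitz_base (x : ℝ) (hx : 0 < x) (hx2 : x ≤ 1 / 2) (s : ℂ) (hs : s.re < 0) :
    2 * HurwitzZeta.hurwitzZetaEven (x : UnitAddCircle) (1 - s) =
      (x : ℂ) ^ (s - 1) + ∑' k, zc k s * (x : ℂ) ^ (2 * k) := by
  have hw : 1 < (1 - s).re := by simp only [Complex.sub_re, Complex.one_re]; linarith
  have h1 := (HurwitzZeta.hasSum_int_hurwitzZetaEven x hw).nat_add_neg
  rw [← hasSum_nat_add_iff' 1] at h1
  simp only [Finset.sum_range_one] at h1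
  have habs : ∀ n : ℕ, |(((n + 1 : ℕ) : ℤ) : ℝ) + x| = (n + 1 : ℝ) * (1 + x / (n + 1)) := by
    intro n
    rw [abs_of_pos (by positivity)]; push_cast; field_simp
  have hxn : ∀ n : ℕ, x / ((n : ℝ) + 1) ≤ 1 / 2 := fun n => by
    rw [div_le_iff₀ (by positivity)]
    have : (0 : ℝ) ≤ n := by positivity
    nlinarith
  have habs' : ∀ n : ℕ, |((-((n + 1 : ℕ) : ℤ) : ℤ) : ℝ) + x| = (n + 1 : ℝ) * (1 - x / (n + 1)) := by
    intro n
    have : (0 : ℝ) ≤ n := by positivity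
    rw [abs_of_neg (by push_cast; linarith)]; push_cast; field_simp; ring
  have hterm : ∀ n : ℕ, HasSum
      (fun k => ((n : ℂ) + 1) ^ (s - 1) * (2 * bin (s - 1) (2 * k) * ((x / ((n : ℝ) + 1) : ℝ) : ℂ) ^ (2 * k)))
      (2 * (1 / ((|(((n + 1 : ℕ) : ℤ) : ℝ) + x| : ℝ) : ℂ) ^ (1 - s) / 2 +
        1 / ((|((-((n + 1 : ℕ) : ℤ) : ℤ) : ℝ) + x| : ℝ) : ℂ) ^ (1 - s) / 2)) := by
    intro n
    have h0 : 0 ≤ x / ((n : ℝ) + 1) := by positivity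
    have := (bin_even_hasSum (s - 1) ((x / ((n : ℝ) + 1) : ℝ) : ℂ) (by
      rw [Complex.norm_real, Real.norm_of_nonneg h0]
      linarith [hxn n])).mul_left (((n : ℂ) + 1) ^ (s - 1))
    refine HasSum.congr_aux this ?_
    rw [habs, habs', Complex.ofReal_mul, Complex.ofReal_mul,
      Complex.mul_cpow_ofReal_nonneg (by positivity) (by linarith [hxn n]),
      Complex.mul_cpow_ofReal_nonneg (by positivity) (by linarith [hxn n])]
    rw [show 1 - s = -(s - 1) by ring, Complex.cpow_neg, Complex.cpow_neg, Complex.cpow_neg]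
    push_cast
    simp only [one_div, mul_inv, inv_inv]
    ring
  set F : ℕ → ℕ → ℂ := fun n k =>
    ((n : ℂ) + 1) ^ (s - 1) * (2 * bin (s - 1) (2 * k) * ((x / ((n : ℝ) + 1) : ℝ) : ℂ) ^ (2 * k)) with hF
  have hFsum : Summable (Function.uncurry F) := by
    have hA : Summable (fun n : ℕ => ((n : ℝ) + 1) ^ (s.re - 1)) := by
      have := (Real.summable_nat_rpow (p := s.re - 1)).2 (by linarith)
      have := this.comp_injective (add_left_injective 1)
      refine this.congr fun n => ?_
      simp
    have hB : Summable (fun k : ℕ => 2 * (rb ‖s‖ (2 * k) * (1 / 2 : ℝ) ^ (2 * k))) :=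
      ((rb_summable (norm_nonneg s)).comp_injective (i := fun k : ℕ => 2 * k)
        (mul_right_injective₀ two_ne_zero)).mul_left 2
    have hAB := hA.mul_of_nonneg hB (fun n => by positivity) (fun k => by
      have := rb_nonneg (norm_nonneg s) (2 * k)
      simp only [Pi.zero_apply]
      positivity)
    refine Summable.of_norm_bounded hAB ?_
    rintro ⟨n, k⟩
    simp only [Function.uncurry, hF, norm_mul, norm_pow]
    have e1 : ‖((n : ℂ) + 1) ^ (s - 1)‖ = ((n : ℝ) + 1) ^ (s.re - 1) := by
      have := Complex.norm_natCast_cpow_of_pos (n := n + 1) (by omega) (s - 1)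
      push_cast at this
      simpa using this
    rw [e1, Complex.norm_real, Real.norm_of_nonneg (show 0 ≤ x / ((n : ℝ) + 1) by positivity),
      Complex.norm_ofNat, mul_assoc 2]
    have := bin_norm_le (le_refl ‖s‖) (2 * k)
    have := hxn n
    have := rb_nonneg (norm_nonneg s) (2 * k)
    gcongr
  have h2 := (h1.mul_left 2).tsum_eq
  have h3 : ∑' n, ∑' k, F n k = _ := (tsum_congr fun n => (hterm n).tsum_eq).trans h2
  rw [← hFsum.tsum_comm] at h3
  have h4 : ∀ k, ∑' n, F n k = zc k s * (x : ℂ) ^ (2 * k) := by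
    intro k
    have hk : 1 < (1 - s + 2 * k : ℂ).re := by
      have : (1 - s + 2 * k : ℂ).re = 1 - s.re + 2 * k := by simp
      rw [this]
      have : (0 : ℝ) ≤ k := by positivity
      linarith
    rw [zc, zeta_eq_tsum_one_div_nat_add_one_cpow hk, mul_right_comm, ← tsum_mul_left]
    refine tsum_congr fun n => ?_
    have hn : (n : ℂ) + 1 ≠ 0 := Nat.cast_add_one_ne_zero n
    simp only [hF]
    rw [show (1 - s + 2 * k : ℂ) = -(s - 1) + ((2 * k : ℕ) : ℂ) by push_cast; ring,
      Complex.cpow_add _ _ hn, Complex.cpow_neg, Complex.cpow_natCast]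
    push_cast
    rw [div_pow, one_div, mul_inv, inv_inv]
    ring
  rw [tsum_congr h4] at h3
  rw [h3]
  have hx0 : |((0 : ℕ) : ℤ) + x| = x := by simp [abs_of_pos hx]
  have hxs : (x : ℂ) ^ (s - 1) = ((x : ℂ) ^ (1 - s))⁻¹ := by
    rw [← Complex.cpow_neg, neg_sub]
  rw [hxs]
  simp [abs_of_pos hx]
  ring

lemma hurwitz_expand (x : ℝ) (hx : 0 < x) (hx2 : x ≤ 1 / 2) (s : ℂ) (hs : 0 < s.im) :
    HasSum (fun i => co i s * (x : ℂ) ^ (ex i s))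
      (2 * HurwitzZeta.hurwitzZetaEven (x : UnitAddCircle) (1 - s)) := by
  have hd : DifferentiableOn ℂ (fun s => ∑' k, zc k s * (x : ℂ) ^ (2 * k)) HH :=
    HH_diff (fun k s => zc k s * (x : ℂ) ^ (2 * k)) (fun k => (zc_diff k).mul_const _)
      (zc_pow_bound x hx hx2)
  have hxc : (x : ℂ) ≠ 0 := by exact_mod_cast hx.ne'
  have hd1 : DifferentiableOn ℂ (fun s => (x : ℂ) ^ (s - 1) + ∑' k, zc k s * (x : ℂ) ^ (2 * k)) HH := by
    apply DifferentiableOn.add _ hd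
    intro s _
    apply DifferentiableAt.differentiableWithinAt
    exact DifferentiableAt.const_cpow (by fun_prop) (Or.inl hxc)
  have hd2 : DifferentiableOn ℂ (fun s => 2 * HurwitzZeta.hurwitzZetaEven (x : UnitAddCircle) (1 - s)) HH := by
    intro s hs
    have hs' : 0 < s.im := hs
    apply DifferentiableAt.differentiableWithinAt
    apply DifferentiableAt.const_mul
    refine DifferentiableAt.comp (f := fun s : ℂ => 1 - s) s
      (HurwitzZeta.differentiableAt_hurwitzZetaEven _ ?_) (by fun_prop)
    intro h
    have := congrArg Complex.im h
    simp at this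
    linarith
  have hconv : Convex ℝ HH := convex_halfSpace_im_gt 0
  have hmem : (-1 + Complex.I) ∈ HH := by show 0 < (-1 + Complex.I).im; simp
  have heq := (hd2.analyticOnNhd HH_open).eqOn_of_preconnected_of_eventuallyEq
    (hd1.analyticOnNhd HH_open) hconv.isPreconnected hmem (by
      have : ∀ᶠ z : ℂ in 𝓝 (-1 + Complex.I), z.re < 0 :=
        (isOpen_lt Complex.continuous_re continuous_const).mem_nhds (by simp)
      filter_upwards [this] with z hz
      exact hurwitz_base x hx hx2 z hz)
  have := heq (show s ∈ HH from hs)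
  simp only at this
  rw [this]
  have hsum : Summable (fun k => zc k s * (x : ℂ) ^ (2 * k)) := by
    obtain ⟨u, hu, hle⟩ := zc_pow_bound x hx hx2 ‖s‖ s.im hs
    exact Summable.of_norm_bounded hu (hle s le_rfl le_rfl)
  have h5 := hasSum_opt (f := fun i => co i s * (x : ℂ) ^ (ex i s)) (a := ∑' k, zc k s * (x : ℂ) ^ (2 * k)) (by
    refine hsum.hasSum.congr_fun fun k => ?_
    simp only [co, ex, Complex.cpow_natCast])
  simpa [co, ex] using h5

lemma summable_triple {ι : Type} {v : ι → ℝ} (hv : Summable v) (h0 : ∀ i, 0 ≤ v i) :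
    Summable (fun t : ι × ι × ι => v t.1 * (v t.2.1 * v t.2.2)) := by
  have h1 : Summable (fun t : ι × ι => v t.1 * v t.2) := hv.mul_of_nonneg hv h0 h0
  exact hv.mul_of_nonneg h1 h0 (fun t => mul_nonneg (h0 _) (h0 _))

lemma cube_integral {ι : Type} [Countable ι] (f : ι → ℝ → ℂ) (g : ℝ → ℂ) (v : ι → ℝ)
    (hv : Summable v)
    (hc : ∀ i, ContinuousOn (f i) (Set.Ioc 0 (1 / 2)))
    (hb : ∀ i, ∀ x ∈ Set.Ioc (0 : ℝ) (1 / 2), ‖f i x‖ ≤ v i)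
    (hg : ∀ x ∈ Set.Ioc (0 : ℝ) (1 / 2), HasSum (fun i => f i x) (g x)) :
    HasSum (fun t : ι × ι × ι => ∫ x in (0 : ℝ)..(1 / 2), f t.1 x * (f t.2.1 x * f t.2.2 x))
      (∫ x in (0 : ℝ)..(1 / 2), g x ^ 3) := by
  have h0 : ∀ i, 0 ≤ v i := fun i =>
    (norm_nonneg _).trans (hb i (1 / 2) ⟨by norm_num, le_rfl⟩)
  have hI : Set.uIoc (0 : ℝ) (1 / 2) = Set.Ioc 0 (1 / 2) := Set.uIoc_of_le (by norm_num)
  apply intervalIntegral.hasSum_integral_of_dominated_convergence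
    (fun t _ => v t.1 * (v t.2.1 * v t.2.2))
  · intro t
    rw [hI]
    exact ((hc _).mul ((hc _).mul (hc _))).aestronglyMeasurable measurableSet_Ioc
  · intro t
    refine Eventually.of_forall fun x hx => ?_
    rw [hI] at hx
    rw [norm_mul, norm_mul]
    have := hb t.1 x hx
    have := hb t.2.1 x hx
    have := hb t.2.2 x hx
    have := h0 t.1
    have := h0 t.2.1
    gcongr
  · exact Eventually.of_forall fun x _ => summable_triple hv h0
  · exact intervalIntegrable_const
  · refine Eventually.of_forall fun x hx => ?_
    rw [hI] at hx
    have hs : Summable (fun i => ‖f i x‖) :=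
      Summable.of_nonneg_of_le (fun _ => norm_nonneg _) (fun i => hb i x hx) hv
    have hs2 : Summable (fun p : ι × ι => ‖f p.1 x * f p.2 x‖) :=
      Summable.mul_norm (f := fun i => f i x) (g := fun i => f i x) hs hs
    have hgx := hg x hx
    have hs2' : Summable (fun p : ι × ι => f p.1 x * f p.2 x) := Summable.of_norm hs2
    have h2 : HasSum (fun p : ι × ι => f p.1 x * f p.2 x) (g x * g x) :=
      HasSum.mul (f := fun i => f i x) (g := fun i => f i x) hgx hgx hs2'
    have hs3 : Summable (fun p : ι × ι × ι => ‖f p.1 x * (f p.2.1 x * f p.2.2 x)‖) :=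
      Summable.mul_norm (f := fun i => f i x) (g := fun p : ι × ι => f p.1 x * f p.2 x) hs hs2
    have hs3' : Summable (fun p : ι × ι × ι => f p.1 x * (f p.2.1 x * f p.2.2 x)) :=
      Summable.of_norm hs3
    have h3 : HasSum (fun p : ι × ι × ι => f p.1 x * (f p.2.1 x * f p.2.2 x))
        (g x * (g x * g x)) :=
      HasSum.mul (f := fun i => f i x) (g := fun p : ι × ι => f p.1 x * f p.2 x) hgx h2 hs3'
    rw [show g x ^ 3 = g x * (g x * g x) by ring]
    exact h3

lemma integral_cos_int (k : ℤ) :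
    (∫ x in (0 : ℝ)..(1 / 2), Real.cos (2 * π * k * x)) = if k = 0 then 1 / 2 else 0 := by
  split_ifs with h
  · subst h; simp
  · have hk : (2 * π * k : ℝ) ≠ 0 := by
      have : (k : ℝ) ≠ 0 := by exact_mod_cast h
      positivity
    rw [intervalIntegral.integral_comp_mul_left (fun y => Real.cos y) hk, integral_cos]
    rw [show 2 * π * (k : ℝ) * (1 / 2) = k * π by ring, Real.sin_int_mul_pi]
    simp

lemma integral_cos3 (a b c : ℕ) :
    (∫ x in (0 : ℝ)..(1 / 2), Real.cos (2 * π * x * a) * (Real.cos (2 * π * x * b) *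
      Real.cos (2 * π * x * c))) = (1 / 8) * ((if a + b + c = 0 then 1 else 0) +
        (if a + b = c then 1 else 0) + (if a + c = b then 1 else 0) +
        (if b + c = a then 1 else 0)) := by
  have h : ∀ x : ℝ, Real.cos (2 * π * x * a) * (Real.cos (2 * π * x * b) *
      Real.cos (2 * π * x * c)) = (1 / 4) * (Real.cos (2 * π * ((a + b + c : ℤ) : ℝ) * x) +
      Real.cos (2 * π * ((a + b - c : ℤ) : ℝ) * x) + Real.cos (2 * π * ((a + c - b : ℤ) : ℝ) * x) +
      Real.cos (2 * π * ((b + c - a : ℤ) : ℝ) * x)) := by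
    intro x
    push_cast
    set A := 2 * π * x * a with hA
    set B := 2 * π * x * b with hB
    set C := 2 * π * x * c with hC
    rw [show 2 * π * ((a : ℝ) + b + c) * x = A + B + C by simp only [hA, hB, hC]; ring,
      show 2 * π * ((a : ℝ) + b - c) * x = A + B - C by simp only [hA, hB, hC]; ring,
      show 2 * π * ((a : ℝ) + c - b) * x = A + C - B by simp only [hA, hB, hC]; ring,
      show 2 * π * ((b : ℝ) + c - a) * x = B + C - A by simp only [hA, hB, hC]; ring]
    simp only [Real.cos_add, Real.cos_sub, Real.sin_add]
    ring
  simp_rw [h]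
  have hi : ∀ k : ℤ, IntervalIntegrable (fun x => Real.cos (2 * π * (k : ℝ) * x))
      MeasureTheory.volume 0 (1 / 2) := fun k => Continuous.intervalIntegrable (by fun_prop) _ _
  rw [intervalIntegral.integral_const_mul, intervalIntegral.integral_add
    (((hi _).add (hi _)).add (hi _)) (hi _), intervalIntegral.integral_add
    ((hi _).add (hi _)) (hi _), intervalIntegral.integral_add (hi _) (hi _)]
  simp only [integral_cos_int]
  have e1 : ((a : ℤ) + b + c = 0) ↔ (a + b + c = 0) := by omega
  have e2 : ((a : ℤ) + b - c = 0) ↔ (a + b = c) := by omega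
  have e3 : ((a : ℤ) + c - b = 0) ↔ (a + c = b) := by omega
  have e4 : ((b : ℤ) + c - a = 0) ↔ (b + c = a) := by omega
  simp only [e1, e2, e3, e4]
  split_ifs <;> norm_num

/-- Dirichlet weight -/
noncomputable def wt (s : ℂ) (n : ℕ) : ℂ := 1 / (n : ℂ) ^ s

lemma wt_zero {s : ℂ} (hs : 1 < s.re) : wt s 0 = 0 := by
  have : s ≠ 0 := by rintro rfl; simp at hs; linarith
  simp [wt, Complex.zero_cpow this]

lemma wt_summable {s : ℂ} (hs : 1 < s.re) : Summable (fun n => ‖wt s n‖) := by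
  have := (Complex.summable_one_div_nat_cpow (p := s)).2 hs
  exact this.norm

/-- weight of a triple -/
noncomputable def wt3 (s : ℂ) (t : ℕ × ℕ × ℕ) : ℂ := wt s t.1 * (wt s t.2.1 * wt s t.2.2)

lemma wt3_summable {s : ℂ} (hs : 1 < s.re) : Summable (fun t => ‖wt3 s t‖) := by
  refine (summable_triple (wt_summable hs) (fun _ => norm_nonneg _)).congr fun t => ?_
  simp [wt3]

lemma tornheim_eq_wt (s : ℂ) (φ : ℕ+ × ℕ+ → ℕ × ℕ × ℕ) (hinj : Function.Injective φ)
    (P : ℕ × ℕ × ℕ → Prop) [DecidablePred P]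
    (hφ : ∀ p, P (φ p)) (hw : ∀ p, wt3 s (φ p) = wt s p.1 * wt s p.2 * wt s (p.1 + p.2))
    (hr : ∀ t, P t → wt3 s t ≠ 0 → t ∈ Set.range φ) :
    ∑' t, wt3 s t * (if P t then 1 else 0) = tornheim s s s := by
  rw [← hinj.tsum_eq (f := fun t => wt3 s t * (if P t then 1 else 0))]
  · unfold tornheim
    refine tsum_congr fun p => ?_
    rw [if_pos (hφ p), hw p]
    simp only [wt]
    push_cast
    simp only [one_div, mul_inv, mul_one]
  · intro t ht
    rw [Function.mem_support] at ht
    by_cases hP : P t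
    · exact hr t hP (left_ne_zero_of_mul ht)
    · simp [hP] at ht

lemma wt3_pos {s : ℂ} (hs : 1 < s.re) {t : ℕ × ℕ × ℕ} (h : wt3 s t ≠ 0) :
    0 < t.1 ∧ 0 < t.2.1 ∧ 0 < t.2.2 := by
  refine ⟨?_, ?_, ?_⟩ <;>
  · rw [Nat.pos_iff_ne_zero]
    intro h0
    apply h
    simp [wt3, h0, wt_zero hs]

lemma tornheim_integral {s : ℂ} (hs : 1 < s.re) :
    tornheim s s s = (8 / 3) * ∫ x in (0 : ℝ)..(1 / 2),
      HurwitzZeta.cosZeta (x : UnitAddCircle) s ^ 3 := by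
  have h1 := cube_integral (fun (n : ℕ) (x : ℝ) => (Real.cos (2 * π * x * n) : ℂ) / (n : ℂ) ^ s)
    (fun x => HurwitzZeta.cosZeta (x : UnitAddCircle) s) (fun n => ‖wt s n‖) (wt_summable hs)
    (fun n => by
      apply Continuous.continuousOn
      apply Continuous.div_const
      exact Complex.continuous_ofReal.comp (by fun_prop))
    (fun n x _ => by
      simp only [wt]
      rw [norm_div, norm_div, norm_one, Complex.norm_real]
      gcongr
      exact Real.abs_cos_le_one _)
    (fun x _ => HurwitzZeta.hasSum_nat_cosZeta x hs)
  have h2 : ∀ t : ℕ × ℕ × ℕ, (∫ x in (0 : ℝ)..(1 / 2),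
      (Real.cos (2 * π * x * t.1) : ℂ) / (t.1 : ℂ) ^ s *
      ((Real.cos (2 * π * x * t.2.1) : ℂ) / (t.2.1 : ℂ) ^ s *
      ((Real.cos (2 * π * x * t.2.2) : ℂ) / (t.2.2 : ℂ) ^ s))) =
      (1 / 8) * (wt3 s t * (if t.1 + t.2.1 = t.2.2 then 1 else 0) +
        wt3 s t * (if t.1 + t.2.2 = t.2.1 then 1 else 0) +
        wt3 s t * (if t.2.1 + t.2.2 = t.1 then 1 else 0)) := by
    rintro ⟨a, b, c⟩
    have hI := congrArg (fun r : ℝ => (r : ℂ)) (integral_cos3 a b c)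
    rw [← intervalIntegral.integral_ofReal] at hI
    have e : ∀ x : ℝ, (Real.cos (2 * π * x * a) : ℂ) / (a : ℂ) ^ s *
      ((Real.cos (2 * π * x * b) : ℂ) / (b : ℂ) ^ s *
      ((Real.cos (2 * π * x * c) : ℂ) / (c : ℂ) ^ s)) = wt3 s (a, b, c) *
      ((Real.cos (2 * π * x * a) * (Real.cos (2 * π * x * b) * Real.cos (2 * π * x * c)) : ℝ) : ℂ) := by
      intro x
      simp only [wt3, wt]
      push_cast
      ring
    simp only [e]
    rw [intervalIntegral.integral_const_mul, hI]
    by_cases h0 : a + b + c = 0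
    · have : a = 0 := by omega
      subst this
      simp [wt3, wt_zero hs]
    · rw [if_neg h0]
      split_ifs <;> push_cast <;> ring
  have h3 := h1.tsum_eq
  rw [tsum_congr h2, tsum_mul_left] at h3
  have hsm : ∀ P : ℕ × ℕ × ℕ → Prop, ∀ _ : DecidablePred P,
      Summable (fun t => wt3 s t * (if P t then 1 else 0)) := by
    intro P _
    refine Summable.of_norm_bounded (wt3_summable hs) fun t => ?_
    split_ifs <;> simp
  rw [Summable.tsum_add ((hsm _ _).add (hsm _ _)) (hsm _ _), Summable.tsum_add (hsm _ _) (hsm _ _)] at h3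
  have hT1 := tornheim_eq_wt s (fun p => ((p.1 : ℕ), (p.2 : ℕ), (p.1 : ℕ) + p.2))
    (fun p q h => by
      simp only [Prod.mk.injEq, PNat.coe_inj] at h
      exact Prod.ext h.1 h.2.1) (fun t => t.1 + t.2.1 = t.2.2) (fun p => rfl)
    (fun p => by simp only [wt3]; ring)
    (fun t hP h => by
      obtain ⟨ha, hb, hc⟩ := wt3_pos hs h
      exact ⟨(⟨t.1, ha⟩, ⟨t.2.1, hb⟩), Prod.ext rfl (Prod.ext rfl hP)⟩)
  have hT2 := tornheim_eq_wt s (fun p => ((p.1 : ℕ), (p.1 : ℕ) + p.2, (p.2 : ℕ)))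
    (fun p q h => by
      simp only [Prod.mk.injEq, PNat.coe_inj] at h
      exact Prod.ext h.1 h.2.2) (fun t => t.1 + t.2.2 = t.2.1) (fun p => rfl)
    (fun p => by simp only [wt3]; ring)
    (fun t hP h => by
      obtain ⟨ha, hb, hc⟩ := wt3_pos hs h
      exact ⟨(⟨t.1, ha⟩, ⟨t.2.2, hc⟩), Prod.ext rfl (Prod.ext hP rfl)⟩)
  have hT3 := tornheim_eq_wt s (fun p => ((p.1 : ℕ) + p.2, (p.1 : ℕ), (p.2 : ℕ)))
    (fun p q h => by
      simp only [Prod.mk.injEq, PNat.coe_inj] at h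
      exact Prod.ext h.2.1 h.2.2) (fun t => t.2.1 + t.2.2 = t.1) (fun p => rfl)
    (fun p => by simp only [wt3]; ring)
    (fun t hP h => by
      obtain ⟨ha, hb, hc⟩ := wt3_pos hs h
      exact ⟨(⟨t.2.1, hb⟩, ⟨t.2.2, hc⟩), Prod.ext hP (Prod.ext rfl rfl)⟩)
  rw [hT1, hT2, hT3] at h3
  rw [← h3]
  ring

/-- exponent of a triple -/
noncomputable def pp (t : Option ℕ × Option ℕ × Option ℕ) (s : ℂ) : ℂ :=
  ex t.1 s + (ex t.2.1 s + ex t.2.2 s) + 1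

/-- term of the triple series -/
noncomputable def tm (t : Option ℕ × Option ℕ × Option ℕ) (s : ℂ) : ℂ :=
  co t.1 s * (co t.2.1 s * co t.2.2 s) * ((1 / 2 : ℂ) ^ (pp t s) / pp t s)

/-- factor from the functional equation -/
noncomputable def BB (s : ℂ) : ℂ :=
  2 * (2 * π : ℂ) ^ (-(1 - s)) * Complex.Gamma (1 - s) * Complex.cos (π * (1 - s) / 2)

/-- the triple series -/
noncomputable def JJ (s : ℂ) : ℂ := ∑' t, tm t s

lemma ex_re_nonneg {s : ℂ} (hs : 1 < s.re) (i : Option ℕ) : 0 ≤ (ex i s).re := by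
  cases i with
  | none => simp [ex]; linarith
  | some k => simp only [ex, Complex.natCast_re]; positivity

lemma tm_integral {s : ℂ} (hs : 1 < s.re) (t : Option ℕ × Option ℕ × Option ℕ) :
    (∫ x in (0 : ℝ)..(1 / 2), (co t.1 s * (x : ℂ) ^ (ex t.1 s)) *
      ((co t.2.1 s * (x : ℂ) ^ (ex t.2.1 s)) * (co t.2.2 s * (x : ℂ) ^ (ex t.2.2 s)))) = tm t s := by
  have h1 := ex_re_nonneg hs t.1
  have h2 := ex_re_nonneg hs t.2.1
  have h3 := ex_re_nonneg hs t.2.2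
  set r := ex t.1 s + (ex t.2.1 s + ex t.2.2 s) with hr
  have hre : 0 ≤ r.re := by simp only [hr, Complex.add_re]; linarith
  have hne : r + 1 ≠ 0 := by
    intro h
    have := congrArg Complex.re h
    simp at this
    linarith
  have e : (∫ x in (0 : ℝ)..(1 / 2), (co t.1 s * (x : ℂ) ^ (ex t.1 s)) *
      ((co t.2.1 s * (x : ℂ) ^ (ex t.2.1 s)) * (co t.2.2 s * (x : ℂ) ^ (ex t.2.2 s)))) =
      ∫ x in (0 : ℝ)..(1 / 2), (co t.1 s * (co t.2.1 s * co t.2.2 s)) * (x : ℂ) ^ r := by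
    apply intervalIntegral.integral_congr_ae
    refine Eventually.of_forall fun x hx => ?_
    rw [Set.uIoc_of_le (by norm_num)] at hx
    have hx0 : (x : ℂ) ≠ 0 := by exact_mod_cast hx.1.ne'
    rw [hr, Complex.cpow_add _ _ hx0, Complex.cpow_add _ _ hx0]
    ring
  rw [e, intervalIntegral.integral_const_mul, integral_cpow (Or.inl (by linarith))]
  simp only [tm, pp, ← hr]
  rw [Complex.ofReal_zero, Complex.zero_cpow hne]
  push_cast
  simp

lemma tornheim_J {s : ℂ} (hs : 1 < s.re) (him : 0 < s.im) :
    tornheim s s s = (8 / 3) * (BB s / 2) ^ 3 * JJ s := by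
  obtain ⟨v, hv, hle⟩ := co_bound ‖s‖ s.im him
  have hle' := hle s le_rfl (norm_sub_int_ge s)
  have h := cube_integral (fun i x => co i s * (x : ℂ) ^ (ex i s))
    (fun x => 2 * HurwitzZeta.hurwitzZetaEven (x : UnitAddCircle) (1 - s)) v hv
    (fun i x hx => by
      apply ContinuousAt.continuousWithinAt
      apply ContinuousAt.mul continuousAt_const
      exact (Complex.continuousAt_ofReal_cpow_const x _ (Or.inr hx.1.ne')))
    (fun i x hx => by
      refine le_trans ?_ (hle' i)
      rw [norm_mul, Complex.norm_cpow_eq_rpow_re_of_pos hx.1]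
      gcongr
      · exact hx.1.le
      · exact ex_re_nonneg hs i
      · exact hx.2)
    (fun x hx => hurwitz_expand x hx.1 hx.2 s him)
  have h' := h.tsum_eq
  rw [tsum_congr (tm_integral hs)] at h'
  have hcz : ∀ x : ℝ, HurwitzZeta.cosZeta (x : UnitAddCircle) s =
      BB s / 2 * (2 * HurwitzZeta.hurwitzZetaEven (x : UnitAddCircle) (1 - s)) := by
    intro x
    have := HurwitzZeta.cosZeta_one_sub (x : UnitAddCircle) (s := 1 - s) (fun n hn => by
      have := congrArg Complex.im hn
      simp at this
      linarith)
    rw [show 1 - (1 - s) = s by ring] at this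
    rw [this, BB]
    ring
  rw [tornheim_integral hs]
  simp only [hcz]
  rw [show (∫ x in (0 : ℝ)..(1 / 2), (BB s / 2 * (2 * HurwitzZeta.hurwitzZetaEven
    (x : UnitAddCircle) (1 - s))) ^ 3) = (BB s / 2) ^ 3 * ∫ x in (0 : ℝ)..(1 / 2),
      (2 * HurwitzZeta.hurwitzZetaEven (x : UnitAddCircle) (1 - s)) ^ 3 by
    rw [← intervalIntegral.integral_const_mul]
    congr 1
    ext x
    ring, ← h', JJ]
  ring

/-- indicator of the singular exponent -/
def oa : Option ℕ → ℕ
  | none => 1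
  | some _ => 0

/-- index -/
def om : Option ℕ → ℕ
  | none => 0
  | some k => k

lemma ex_eq (i : Option ℕ) (s : ℂ) : ex i s = (oa i : ℂ) * (s - 1) + 2 * (om i : ℂ) := by
  cases i <;> simp [ex, oa, om]

lemma pp_eq (t : Option ℕ × Option ℕ × Option ℕ) (s : ℂ) :
    pp t s = ((oa t.1 + oa t.2.1 + oa t.2.2 : ℕ) : ℂ) * (s - 1) +
      ((2 * (om t.1 + om t.2.1 + om t.2.2) + 1 : ℕ) : ℂ) := by
  simp only [pp, ex_eq]
  push_cast
  ring

lemma pp_lower (t : Option ℕ × Option ℕ × Option ℕ) (s : ℂ) (hs : 0 < s.im) :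
    min s.im 1 ≤ ‖pp t s‖ := by
  have h1 := pp_eq t s
  set α := oa t.1 + oa t.2.1 + oa t.2.2
  set m := 2 * (om t.1 + om t.2.1 + om t.2.2) + 1 with hm
  rcases Nat.eq_zero_or_pos α with h0 | h0
  · rw [h1, h0]
    apply (min_le_right _ _).trans
    simp only [Nat.cast_zero, zero_mul, zero_add, Complex.norm_natCast]
    exact_mod_cast (by omega : 1 ≤ m)
  · apply (min_le_left _ _).trans
    refine le_trans ?_ (Complex.abs_im_le_norm _)
    rw [h1]
    simp only [Complex.add_im, Complex.mul_im, Complex.natCast_re, Complex.natCast_im,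
      Complex.sub_im, Complex.one_im, sub_zero, zero_mul, add_zero]
    have : (1 : ℝ) ≤ α := by exact_mod_cast h0
    refine le_trans ?_ (le_abs_self _)
    nlinarith

lemma pp_ne (t : Option ℕ × Option ℕ × Option ℕ) (s : ℂ) (hs : 0 < s.im) : pp t s ≠ 0 := by
  have h := pp_lower t s hs
  intro h0
  rw [h0, norm_zero] at h
  have : 0 < min s.im 1 := lt_min hs one_pos
  linarith

lemma half_cpow_norm (w : ℂ) : ‖(1 / 2 : ℂ) ^ w‖ = (1 / 2 : ℝ) ^ w.re := by
  have := Complex.norm_cpow_eq_rpow_re_of_pos (x := 1 / 2) (by norm_num) w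
  rw [← this]
  push_cast
  rfl

lemma tm_norm (t : Option ℕ × Option ℕ × Option ℕ) (s : ℂ) :
    ‖tm t s‖ = ((‖co t.1 s‖ * (1 / 2 : ℝ) ^ (ex t.1 s).re) *
      ((‖co t.2.1 s‖ * (1 / 2 : ℝ) ^ (ex t.2.1 s).re) *
       (‖co t.2.2 s‖ * (1 / 2 : ℝ) ^ (ex t.2.2 s).re))) * ((1 / 2) / ‖pp t s‖) := by
  have h : (1 / 2 : ℝ) ^ (pp t s).re = (1 / 2 : ℝ) ^ (ex t.1 s).re *
      ((1 / 2 : ℝ) ^ (ex t.2.1 s).re * (1 / 2 : ℝ) ^ (ex t.2.2 s).re) * (1 / 2) := by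
    simp only [pp, Complex.add_re, Complex.one_re]
    rw [Real.rpow_add (by norm_num), Real.rpow_add (by norm_num), Real.rpow_add (by norm_num),
      Real.rpow_one]
  rw [tm, norm_mul, norm_mul, norm_mul, norm_div, half_cpow_norm, h]
  ring

lemma tm_bound {v : Option ℕ → ℝ} {s : ℂ}
    (hle : ∀ i, ‖co i s‖ * (1 / 2 : ℝ) ^ (ex i s).re ≤ v i)
    (t : Option ℕ × Option ℕ × Option ℕ) :
    ‖tm t s‖ ≤ v t.1 * (v t.2.1 * v t.2.2) * ((1 / 2) / ‖pp t s‖) := by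
  have h0 : ∀ i, 0 ≤ v i := fun i => le_trans (by positivity) (hle i)
  rw [tm_norm]
  have := hle t.1
  have := hle t.2.1
  have := hle t.2.2
  have := h0 t.1
  have := h0 t.2.1
  gcongr

lemma summable_triple_abs {v : Option ℕ → ℝ} (hv : Summable v) :
    Summable (fun t : Option ℕ × Option ℕ × Option ℕ => |v t.1| * (|v t.2.1| * |v t.2.2|)) :=
  summable_triple hv.abs (fun _ => abs_nonneg _)

lemma ex_diff (i : Option ℕ) : Differentiable ℂ (ex i) := by
  cases i with
  | none => exact differentiable_id.sub_const 1
  | some k => exact differentiable_const _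

lemma pp_diff (t : Option ℕ × Option ℕ × Option ℕ) : Differentiable ℂ (pp t) :=
  (((ex_diff _).add ((ex_diff _).add (ex_diff _))).add_const 1)

lemma co_diff (i : Option ℕ) : DifferentiableOn ℂ (co i) HH := by
  cases i with
  | none => exact differentiableOn_const _
  | some k => exact zc_diff k

lemma tm_diff (t : Option ℕ × Option ℕ × Option ℕ) : DifferentiableOn ℂ (tm t) HH := by
  apply DifferentiableOn.mul
  · exact (co_diff _).mul ((co_diff _).mul (co_diff _))
  · apply DifferentiableOn.div
    · exact ((pp_diff t).const_cpow (Or.inl (by norm_num))).differentiableOn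
    · exact (pp_diff t).differentiableOn
    · exact fun s hs => pp_ne t s hs

lemma JJ_diff : DifferentiableOn ℂ JJ HH := by
  apply HH_diff tm tm_diff
  intro R δ hδ
  obtain ⟨v, hv, hle⟩ := co_bound R δ hδ
  refine ⟨fun t => |v t.1| * (|v t.2.1| * |v t.2.2|) * ((1 / 2) / min δ 1),
    (summable_triple_abs hv).mul_right _, ?_⟩
  intro s hR hs t
  have h1 : ∀ i, ‖co i s‖ * (1 / 2 : ℝ) ^ (ex i s).re ≤ |v i| := fun i =>
    (hle s hR (fun n => hs.trans (norm_sub_int_ge s n)) i).trans (le_abs_self _)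
  refine (tm_bound (v := fun i => |v i|) h1 t).trans ?_
  have h2 : min δ 1 ≤ ‖pp t s‖ := le_trans (min_le_min_right _ hs) (pp_lower t s (hδ.trans_le hs))
  have h3 : 0 < min δ 1 := lt_min hδ one_pos
  beta_reduce
  refine mul_le_mul_of_nonneg_left ?_ (by positivity)
  exact div_le_div_of_nonneg_left (by norm_num) h3 h2

/-- the half-integral base point -/
noncomputable def s0 (K : ℕ) : ℂ := 1 / 2 - K

lemma s0_sub_int (K : ℕ) (τ : ℝ) (n : ℤ) : (1 / 2 : ℝ) ≤ ‖s0 K + τ * I - n‖ := by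
  refine le_trans ?_ (Complex.abs_re_le_norm _)
  have : (s0 K + τ * I - n).re = 1 / 2 - ((K + n : ℤ) : ℝ) := by
    simp [s0]; ring
  rw [this]
  rcases le_or_gt (K + n : ℤ) 0 with h | h
  · have h' : ((K + n : ℤ) : ℝ) ≤ 0 := by exact_mod_cast h
    rw [abs_of_nonneg (by linarith)]; linarith
  · have h' : (1 : ℝ) ≤ ((K + n : ℤ) : ℝ) := by exact_mod_cast h
    rw [abs_of_nonpos (by linarith)]; linarith

lemma co_cont (K : ℕ) (i : Option ℕ) : ContinuousAt (co i) (s0 K) := by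
  cases i with
  | none => exact continuousAt_const
  | some k =>
    have hne : 1 - s0 K + 2 * k ≠ 1 := by
      intro h
      have h1 := s0_sub_int K 0 (2 * k)
      have : s0 K + ((0 : ℝ) : ℂ) * I - ((2 * k : ℤ) : ℂ) = 0 := by
        push_cast
        linear_combination -h
      rw [this, norm_zero] at h1
      norm_num at h1
    have h1 : ContinuousAt (fun s : ℂ => riemannZeta (1 - s + 2 * k)) (s0 K) :=
      ContinuousAt.comp (f := fun s : ℂ => 1 - s + 2 * k) (g := riemannZeta)
        (differentiableAt_riemannZeta hne).continuousAt (by fun_prop)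
    have h2 : ContinuousAt (fun s : ℂ => bin (s - 1) (2 * k)) (s0 K) :=
      ContinuousAt.comp (f := fun s : ℂ => s - 1) (g := fun a => bin a (2 * k))
        (bin_differentiable _).continuous.continuousAt (by fun_prop)
    exact (continuousAt_const.mul h2).mul h1

/-- the exceptional triples -/
def SS (K : ℕ) : Finset (Option ℕ × Option ℕ × Option ℕ) :=
  {(none, none, some K), (none, some K, none), (some K, none, none)}

lemma pp_s0_ne (K : ℕ) (t : Option ℕ × Option ℕ × Option ℕ) (ht : t ∉ SS K) : pp t (s0 K) ≠ 0 := by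
  intro h
  rw [pp_eq, s0] at h
  have h2 : ((oa t.1 + oa t.2.1 + oa t.2.2 : ℕ) : ℤ) * (- 1 - 2 * K) +
      2 * ((2 * (om t.1 + om t.2.1 + om t.2.2) + 1 : ℕ) : ℤ) = 0 := by
    have : (((oa t.1 + oa t.2.1 + oa t.2.2 : ℕ) : ℤ) * (- 1 - 2 * K) +
      2 * ((2 * (om t.1 + om t.2.1 + om t.2.2) + 1 : ℕ) : ℤ) : ℂ) = 0 := by
      push_cast at h ⊢
      linear_combination 2 * h
    exact_mod_cast this
  obtain ⟨a, b, c⟩ := t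
  simp only [SS, Finset.mem_insert, Finset.mem_singleton, Prod.mk.injEq, not_or] at ht
  rcases a with _ | a <;> rcases b with _ | b <;> rcases c with _ | c <;>
    simp [oa, om] at h2 ht <;> omega

lemma pp_SS (K : ℕ) (t : Option ℕ × Option ℕ × Option ℕ) (ht : t ∈ SS K) (s : ℂ) :
    pp t s = 2 * s - 1 + 2 * K ∧ co t.1 s * (co t.2.1 s * co t.2.2 s) = zc K s := by
  simp only [SS, Finset.mem_insert, Finset.mem_singleton] at ht
  rcases ht with rfl | rfl | rfl <;> constructor <;> simp [pp, ex, co] <;> ring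

lemma J_limit (K : ℕ) : Tendsto (fun τ : ℝ => (2 * τ * I) * JJ (s0 K + τ * I)) (𝓝[>] 0)
    (𝓝 (3 * zc K (s0 K))) := by
  have hlim : (3 * zc K (s0 K)) = ∑' t, (if t ∈ SS K then zc K (s0 K) else 0) := by
    rw [tsum_eq_sum (s := SS K) (fun t ht => if_neg ht), Finset.sum_congr rfl (fun t ht => if_pos ht),
      Finset.sum_const, show (SS K).card = 3 by simp [SS]]
    simp
  rw [hlim]
  simp only [JJ, ← tsum_mul_left]
  obtain ⟨v, hv, hle⟩ := co_bound (‖s0 K‖ + 1) (1 / 2) (by norm_num)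
  have hev : ∀ᶠ τ : ℝ in 𝓝[>] 0, τ ∈ Set.Ioo (0 : ℝ) 1 := Ioo_mem_nhdsGT one_pos
  have hpath : Tendsto (fun τ : ℝ => s0 K + τ * I) (𝓝[>] 0) (𝓝 (s0 K)) := by
    have : Continuous (fun τ : ℝ => s0 K + τ * I) := by fun_prop
    have h := this.tendsto 0
    simp only [Complex.ofReal_zero, zero_mul, add_zero] at h
    exact h.mono_left nhdsWithin_le_nhds
  refine tendsto_tsum_of_dominated_convergence
    (bound := fun t => |v t.1| * (|v t.2.1| * |v t.2.2|)) (summable_triple_abs hv) ?_ ?_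
  · intro t
    have hco : Tendsto (fun s => co t.1 s * (co t.2.1 s * co t.2.2 s)) (𝓝 (s0 K))
        (𝓝 (co t.1 (s0 K) * (co t.2.1 (s0 K) * co t.2.2 (s0 K)))) :=
      (co_cont K _).mul ((co_cont K _).mul (co_cont K _))
    have hpw : Continuous (fun s => (1 / 2 : ℂ) ^ (pp t s)) :=
      ((pp_diff t).const_cpow (Or.inl (by norm_num))).continuous
    by_cases ht : t ∈ SS K
    · rw [if_pos ht]
      have h1 := (hco.mul (hpw.tendsto (s0 K))).comp hpath
      have hp0 : pp t (s0 K) = 0 := by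
        rw [(pp_SS K t ht _).1, s0]; ring
      rw [(pp_SS K t ht _).2, hp0, Complex.cpow_zero, mul_one] at h1
      refine h1.congr' ?_
      filter_upwards [hev] with τ hτ
      have hp : pp t (s0 K + τ * I) = 2 * τ * I := by
        rw [(pp_SS K t ht _).1, s0]; ring
      have : (2 * τ * I : ℂ) ≠ 0 := by
        have : (τ : ℂ) ≠ 0 := by exact_mod_cast hτ.1.ne'
        simp [this]
      simp only [Function.comp, tm, hp]
      generalize (2 * τ * I : ℂ) = w at this ⊢
      field_simp
    · rw [if_neg ht]
      have hp : pp t (s0 K) ≠ 0 := pp_s0_ne K t ht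
      have h1 := (hco.mul ((hpw.tendsto (s0 K)).div ((pp_diff t).continuous.tendsto (s0 K)) hp)).comp hpath
      have h2 : Tendsto (fun τ : ℝ => (2 * τ * I : ℂ)) (𝓝[>] 0) (𝓝 0) := by
        have : Continuous (fun τ : ℝ => (2 * τ * I : ℂ)) := by fun_prop
        have h := this.tendsto 0
        simp only [Complex.ofReal_zero, zero_mul, mul_zero] at h
        exact h.mono_left nhdsWithin_le_nhds
      have h3 := h2.mul h1
      rw [zero_mul] at h3
      exact h3
  · filter_upwards [hev] with τ hτ t
    have hn : ‖s0 K + τ * I‖ ≤ ‖s0 K‖ + 1 := by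
      refine (norm_add_le _ _).trans ?_
      rw [norm_mul, Complex.norm_real, Complex.norm_I, mul_one, Real.norm_of_nonneg hτ.1.le]
      linarith [hτ.2]
    have h1 : ∀ i, ‖co i (s0 K + τ * I)‖ * (1 / 2 : ℝ) ^ (ex i (s0 K + τ * I)).re ≤ |v i| := fun i =>
      (hle _ hn (s0_sub_int K τ) i).trans (le_abs_self _)
    have him : (s0 K + τ * I).im = τ := by simp [s0]
    have h2 := pp_lower t (s0 K + τ * I) (by rw [him]; exact hτ.1)
    rw [him, min_eq_left hτ.2.le] at h2
    have h3 := tm_bound (v := fun i => |v i|) h1 t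
    rw [norm_mul]
    have h4 : ‖(2 * τ * I : ℂ)‖ = 2 * τ := by
      simp [abs_of_pos hτ.1]
    rw [h4]
    have hτ0 := hτ.1
    calc 2 * τ * ‖tm t (s0 K + τ * I)‖ ≤ 2 * τ * (|v t.1| * (|v t.2.1| * |v t.2.2|) *
          ((1 / 2) / τ)) := by
          refine mul_le_mul_of_nonneg_left (h3.trans ?_) (by positivity)
          gcongr
      _ = _ := by field_simp

lemma BB_diff {s : ℂ} (hs : ∀ m : ℕ, 1 - s ≠ -m) : DifferentiableAt ℂ BB s := by
  have h2 : (2 * π : ℂ) ≠ 0 := by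
    have : (π : ℂ) ≠ 0 := by exact_mod_cast Real.pi_ne_zero
    simp [this]
  apply DifferentiableAt.mul
  · apply DifferentiableAt.mul
    · exact (DifferentiableAt.const_cpow (by fun_prop) (Or.inl h2)).const_mul 2
    · exact DifferentiableAt.comp (f := fun s : ℂ => 1 - s) (g := Complex.Gamma) s
        (Complex.differentiableAt_Gamma _ hs) (by fun_prop)
  · fun_prop

lemma BB_s0_ne (K : ℕ) : BB (s0 K) ≠ 0 := by
  have h2 : (2 * π : ℂ) ≠ 0 := by
    have : (π : ℂ) ≠ 0 := by exact_mod_cast Real.pi_ne_zero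
    simp [this]
  unfold BB
  refine mul_ne_zero (mul_ne_zero (mul_ne_zero two_ne_zero ?_) ?_) ?_
  · rw [Complex.cpow_def_of_ne_zero h2]
    exact Complex.exp_ne_zero _
  · apply Complex.Gamma_ne_zero_of_re_pos
    simp [s0]
    have : (0 : ℝ) ≤ K := by positivity
    linarith
  · intro h
    rw [Complex.cos_eq_zero_iff] at h
    obtain ⟨k, hk⟩ := h
    have hpi : (π : ℂ) ≠ 0 := by exact_mod_cast Real.pi_ne_zero
    have h1 : (1 - s0 K) = 2 * k + 1 := by
      apply mul_left_cancel₀ hpi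
      linear_combination 2 * hk
    rw [s0] at h1
    have h3 : ((1 + 2 * K : ℤ) : ℂ) = ((4 * k + 2 : ℤ) : ℂ) := by
      push_cast
      linear_combination 2 * h1
    have h4 : (1 + 2 * K : ℤ) = 4 * k + 2 := by exact_mod_cast h3
    omega

lemma zc_s0_ne (K : ℕ) (hK : 1 ≤ K) : zc K (s0 K) ≠ 0 := by
  unfold zc
  refine mul_ne_zero (mul_ne_zero two_ne_zero ?_) ?_
  · unfold bin
    rw [Finset.prod_ne_zero_iff]
    intro j _
    apply div_ne_zero
    · intro h
      have h1 := s0_sub_int K 0 (1 + j)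
      rw [show s0 K + ((0 : ℝ) : ℂ) * I - ((1 + j : ℤ) : ℂ) = 0 by
        push_cast; linear_combination h, norm_zero] at h1
      norm_num at h1
    · exact Nat.cast_add_one_ne_zero j
  · apply riemannZeta_ne_zero_of_one_lt_re
    have : (1 : ℝ) ≤ K := by exact_mod_cast hK
    simp [s0]
    linarith

lemma s0_inj : Function.Injective (fun K : ℕ => s0 (K + 1)) := by
  intro m n h
  simp only [s0] at h
  have : (m : ℂ) = n := by
    push_cast at h
    linear_combination -h
  exact_mod_cast this

lemma rhs_diff {j q : ℕ} (c : Fin j → ℂ) (a b : Fin j → Fin q → ℂ) (d : Fin j → Fin q → ℕ) :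
    ∃ E : Finset ℂ, ∀ s ∉ E, DifferentiableAt ℂ (fun s => ∑ k : Fin j, c k * ∏ r : Fin q,
          (riemannZeta (a k r * s + b k r)) ^ (d k r)) s := by
  classical
  refine ⟨(Finset.univ : Finset (Fin j × Fin q)).image (fun p => (1 - b p.1 p.2) / a p.1 p.2), ?_⟩
  intro s hs
  have hs' : ∀ k r, s ≠ (1 - b k r) / a k r := by
    intro k r h
    exact hs (Finset.mem_image.2 ⟨(k, r), Finset.mem_univ _, h.symm⟩)
  apply DifferentiableAt.fun_sum
  intro k _
  apply DifferentiableAt.const_mul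
  apply DifferentiableAt.fun_finsetProd
  intro r _
  apply DifferentiableAt.pow
  by_cases ha : a k r = 0
  · simp only [ha, zero_mul]
    exact differentiableAt_const _
  · have h1 : a k r * s + b k r ≠ 1 := by
      intro h
      apply hs' k r
      rw [eq_div_iff ha]
      linear_combination h
    exact DifferentiableAt.comp (f := fun s : ℂ => a k r * s + b k r) (g := riemannZeta) s
      (differentiableAt_riemannZeta h1) (by fun_prop)

lemma main_aux (F : ℂ → ℂ) (E : Finset ℂ) (hE : ∀ s ∉ E, DifferentiableAt ℂ F s)
    (hF : ∀ s : ℂ, 2 / 3 < s.re → tornheim s s s = F s) : False := by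
  obtain ⟨η, hη0, hη⟩ : ∃ η : ℝ, 0 < η ∧ ∀ e ∈ E, 0 < e.im → η < e.im := by
    have h1 : ∀ᶠ η : ℝ in 𝓝[>] 0, ∀ e ∈ E, 0 < e.im → η < e.im := by
      rw [Filter.eventually_all_finset]
      intro e _
      by_cases he : 0 < e.im
      · filter_upwards [Ioo_mem_nhdsGT he] with η h _ using h.2
      · exact Eventually.of_forall fun _ h => absurd h he
    obtain ⟨η, h, h0⟩ := (h1.and self_mem_nhdsWithin).exists
    exact ⟨η, h0, h⟩
  set G : ℂ → ℂ := fun s => (8 / 3) * (BB s / 2) ^ 3 * JJ s with hG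
  set U : Set ℂ := {s | 0 < s.im} ∩ {s | s.im < η} with hU
  have hUo : IsOpen U := (isOpen_lt continuous_const Complex.continuous_im).inter
    (isOpen_lt Complex.continuous_im continuous_const)
  have hUc : IsPreconnected U :=
    ((convex_halfSpace_im_gt 0).inter (convex_halfSpace_im_lt η)).isPreconnected
  have hFU : DifferentiableOn ℂ F U := fun s hs =>
    (hE s (fun h => by
      have h1 : 0 < s.im := hs.1
      have h2 : s.im < η := hs.2
      linarith [hη s h h1])).differentiableWithinAt
  have hGU : DifferentiableOn ℂ G U := by
    intro s hs
    have h1 : 0 < s.im := hs.1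
    have hb : DifferentiableAt ℂ BB s := BB_diff (fun m h => by
      have := congrArg Complex.im h
      simp at this
      linarith)
    have hj : DifferentiableAt ℂ JJ s := JJ_diff.differentiableAt (HH_open.mem_nhds h1)
    exact (((hb.div_const 2).pow 3).const_mul (8 / 3) |>.mul hj).differentiableWithinAt
  have heq : Set.EqOn F G U := by
    have hz : (2 + (η / 2 : ℝ) * I : ℂ) ∈ U := by
      constructor
      · show 0 < (2 + (η / 2 : ℝ) * I : ℂ).im
        simp; linarith
      · show (2 + (η / 2 : ℝ) * I : ℂ).im < η
        simp; linarith
    refine (hFU.analyticOnNhd hUo).eqOn_of_preconnected_of_eventuallyEq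
      (hGU.analyticOnNhd hUo) hUc hz ?_
    have hV : IsOpen ({s : ℂ | 1 < s.re} ∩ {s | 0 < s.im}) :=
      (isOpen_lt continuous_const Complex.continuous_re).inter
      (isOpen_lt continuous_const Complex.continuous_im)
    have hzV : (2 + (η / 2 : ℝ) * I : ℂ) ∈ ({s : ℂ | 1 < s.re} ∩ {s | 0 < s.im}) := by
      refine ⟨?_, hz.1⟩
      show 1 < (2 + (η / 2 : ℝ) * I : ℂ).re
      simp
    filter_upwards [hV.mem_nhds hzV] with s hs
    have h1 : 1 < s.re := hs.1
    rw [← hF s (by linarith), tornheim_J hs.1 hs.2]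
  obtain ⟨s', ⟨K', hK'⟩, hs'⟩ := (Set.infinite_range_of_injective s0_inj).exists_notMem_finset E
  obtain ⟨K, hK1, hKE⟩ : ∃ K : ℕ, 1 ≤ K ∧ s0 K ∉ E := ⟨K' + 1, by omega, by rw [← hK'] at hs'; exact hs'⟩
  have hpath : Tendsto (fun τ : ℝ => s0 K + τ * I) (𝓝[>] 0) (𝓝 (s0 K)) := by
    have : Continuous (fun τ : ℝ => s0 K + τ * I) := by fun_prop
    have h := this.tendsto 0
    simp only [Complex.ofReal_zero, zero_mul, add_zero] at h
    exact h.mono_left nhdsWithin_le_nhds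
  have h2 : Tendsto (fun τ : ℝ => (2 * τ * I : ℂ)) (𝓝[>] 0) (𝓝 0) := by
    have : Continuous (fun τ : ℝ => (2 * τ * I : ℂ)) := by fun_prop
    have h := this.tendsto 0
    simp only [Complex.ofReal_zero, zero_mul, mul_zero] at h
    exact h.mono_left nhdsWithin_le_nhds
  have hL := h2.mul ((hE _ hKE).continuousAt.tendsto.comp hpath)
  rw [zero_mul] at hL
  have hb : ContinuousAt BB (s0 K) := (BB_diff (fun m h => by
    have h' := congrArg Complex.re h
    simp [s0] at h'
    have : (0 : ℝ) ≤ K := by positivity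
    have : (0 : ℝ) ≤ m := by positivity
    linarith)).continuousAt
  have hb2 : Tendsto (fun s => (8 / 3 : ℂ) * (BB s / 2) ^ 3) (𝓝 (s0 K))
      (𝓝 ((8 / 3 : ℂ) * (BB (s0 K) / 2) ^ 3)) :=
    ((hb.tendsto.div_const 2).pow 3).const_mul (8 / 3)
  have hR := (hb2.comp hpath).mul (J_limit K)
  have hLR := hL.congr' (f₂ := fun τ : ℝ => ((fun s => (8 / 3 : ℂ) * (BB s / 2) ^ 3) ∘
      fun τ : ℝ => s0 K + τ * I) τ * ((2 * τ * I) * JJ (s0 K + τ * I))) (by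
    filter_upwards [Ioo_mem_nhdsGT hη0] with τ hτ
    have hmem : s0 K + τ * I ∈ U := by
      have him : (s0 K + τ * I).im = τ := by simp [s0]
      constructor
      · show 0 < (s0 K + τ * I).im
        rw [him]; exact hτ.1
      · show (s0 K + τ * I).im < η
        rw [him]; exact hτ.2
    have := heq hmem
    simp only [Function.comp, this, hG]
    ring)
  have h0 := tendsto_nhds_unique hLR hR
  have hBn := BB_s0_ne K
  have hzn := zc_s0_ne K hK1
  have : (8 / 3 : ℂ) * (BB (s0 K) / 2) ^ 3 * (3 * zc K (s0 K)) ≠ 0 := by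
    refine mul_ne_zero (mul_ne_zero (by norm_num) (pow_ne_zero _ (div_ne_zero hBn two_ne_zero)))
      (mul_ne_zero (by norm_num) hzn)
  exact this h0.symm

theorem tornheim_diag_not_zeta_polynomial :
    ¬ ∃ (j q : ℕ) (_ : 0 < j) (_ : 0 < q) (c : Fin j → ℂ) (a b : Fin j → Fin q → ℂ)
        (d : Fin j → Fin q → ℕ),
      ∀ s : ℂ, 2 / 3 < s.re →
        tornheim s s s = ∑ k : Fin j, c k * ∏ r : Fin q,
          (riemannZeta (a k r * s + b k r)) ^ (d k r) := by
  rintro ⟨j, q, _, _, c, a, b, d, h⟩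
  obtain ⟨E, hE⟩ := rhs_diff c a b d
  exact main_aux _ E hE h
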